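/- Let r ∈ (0,1) and suppose p̂, p₀, p̌ ∈ (0,1) satisfy 2·E(p̂)/K(p̂) − 1 = r, 2·E(p₀)/K(p₀) − 1 = 0, and 1 − 2·E(p̌)/K(p̌) = r. Then 0 < p̂ < p₀ < p̌ < 1. -/

import Mathlib

/-- Complete elliptic integral of the first kind. -/
noncomputable def ellipticK (p : ℝ) : ℝ :=
  ∫ z in (0:ℝ)..1, 1 / (Real.sqrt (1 - z ^ 2) * Real.sqrt (1 - p ^ 2 * z ^ 2))

/-- Complete elliptic integral of the second kind. -/
noncomputable def ellipticE (p : ℝ) : ℝ :=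
  ∫ z in (0:ℝ)..1, Real.sqrt (1 - p ^ 2 * z ^ 2) / Real.sqrt (1 - z ^ 2)

open Set MeasureTheory

lemma one_sub_sq_mul_sq_pos {p z : ℝ} (hp : p ∈ Ico (0:ℝ) 1) (hz : z ∈ Icc (0:ℝ) 1) :
    0 < 1 - p ^ 2 * z ^ 2 := by
  have h1 : p ^ 2 < 1 := by nlinarith [hp.1, hp.2]
  have h2 : z ^ 2 ≤ 1 := by nlinarith [hz.1, hz.2]
  nlinarith [sq_nonneg p, sq_nonneg z]

lemma intervalIntegrable_one_div_sqrt_one_sub_sq :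
    IntervalIntegrable (fun z : ℝ => 1 / Real.sqrt (1 - z ^ 2)) volume 0 1 := by
  apply intervalIntegral.intervalIntegrable_deriv_of_nonneg (g := Real.arcsin)
  · exact Real.continuous_arcsin.continuousOn
  · intro x hx
    simp only [zero_le_one, min_eq_left, max_eq_right, mem_Ioo] at hx
    exact Real.hasDerivAt_arcsin (by linarith) (by linarith)
  · intro x _
    positivity

lemma intervalIntegrable_ellipticE (p : ℝ) :
    IntervalIntegrable (fun z : ℝ => Real.sqrt (1 - p ^ 2 * z ^ 2) / Real.sqrt (1 - z ^ 2))
      volume 0 1 := by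
  have hcont : ContinuousOn (fun z : ℝ => Real.sqrt (1 - p ^ 2 * z ^ 2)) (uIcc 0 1) := by
    fun_prop
  refine (intervalIntegrable_one_div_sqrt_one_sub_sq.continuousOn_mul hcont).congr ?_
  intro z _
  simp [div_eq_mul_inv]

lemma intervalIntegrable_ellipticK {p : ℝ} (hp : p ∈ Ico (0:ℝ) 1) :
    IntervalIntegrable
      (fun z : ℝ => 1 / (Real.sqrt (1 - z ^ 2) * Real.sqrt (1 - p ^ 2 * z ^ 2))) volume 0 1 := by
  have hcont : ContinuousOn (fun z : ℝ => (Real.sqrt (1 - p ^ 2 * z ^ 2))⁻¹) (uIcc 0 1) := by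
    refine ContinuousOn.inv₀ (by fun_prop) fun z hz => ?_
    rw [uIcc_of_le zero_le_one] at hz
    exact (Real.sqrt_pos.2 (one_sub_sq_mul_sq_pos hp hz)).ne'
  refine (intervalIntegrable_one_div_sqrt_one_sub_sq.continuousOn_mul hcont).congr ?_
  intro z _
  simp [mul_comm]

lemma ellipticE_nonneg (p : ℝ) : 0 ≤ ellipticE p :=
  intervalIntegral.integral_nonneg zero_le_one fun _ _ => by positivity

lemma ellipticK_pos {p : ℝ} (hp : p ∈ Ico (0:ℝ) 1) : 0 < ellipticK p := by
  refine intervalIntegral.intervalIntegral_pos_of_pos_on (intervalIntegrable_ellipticK hp)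
    (fun z hz => ?_) zero_lt_one
  have h1 := Real.sqrt_pos.2 (one_sub_sq_mul_sq_pos hp (Ioo_subset_Icc_self hz))
  have h2 : 0 < Real.sqrt (1 - z ^ 2) := Real.sqrt_pos.2 (by nlinarith [hz.1, hz.2])
  positivity

lemma antitoneOn_ellipticE : AntitoneOn ellipticE (Ici 0) := by
  intro p hp q _ hpq
  rw [mem_Ici] at hp
  refine intervalIntegral.integral_mono_on zero_le_one (intervalIntegrable_ellipticE q)
    (intervalIntegrable_ellipticE p) fun z _ => ?_
  gcongr

lemma monotoneOn_ellipticK : MonotoneOn ellipticK (Ico 0 1) := by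
  intro p hp q hq hpq
  refine intervalIntegral.integral_mono_on_of_le_Ioo zero_le_one (intervalIntegrable_ellipticK hp)
    (intervalIntegrable_ellipticK hq) fun z hz => ?_
  have h1 := Real.sqrt_pos.2 (one_sub_sq_mul_sq_pos hq (Ioo_subset_Icc_self hz))
  have h2 : 0 < Real.sqrt (1 - z ^ 2) := Real.sqrt_pos.2 (by nlinarith [hz.1, hz.2])
  have h3 := hp.1
  gcongr

lemma antitoneOn_ellipticE_div_ellipticK :
    AntitoneOn (fun p => ellipticE p / ellipticK p) (Ico 0 1) := fun p hp _ hq hpq =>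
  div_le_div₀ (ellipticE_nonneg p) (antitoneOn_ellipticE hp.1 hq.1 hpq) (ellipticK_pos hp)
    (monotoneOn_ellipticK hp hq hpq)

theorem pHat_lt_pZero_lt_pCheck {r pHat pZero pCheck : ℝ} (hr : r ∈ Set.Ioo (0:ℝ) 1)
    (hpHat : pHat ∈ Set.Ioo (0:ℝ) 1) (hpZero : pZero ∈ Set.Ioo (0:ℝ) 1)
    (hpCheck : pCheck ∈ Set.Ioo (0:ℝ) 1)
    (h1 : 2 * ellipticE pHat / ellipticK pHat - 1 = r)
    (h2 : 2 * ellipticE pZero / ellipticK pZero - 1 = 0)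
    (h3 : 1 - 2 * ellipticE pCheck / ellipticK pCheck = r) :
    0 < pHat ∧ pHat < pZero ∧ pZero < pCheck ∧ pCheck < 1 := by
  rw [mul_div_assoc] at h1 h2 h3
  have hr0 := hr.1
  refine ⟨hpHat.1, ?_, ?_, hpCheck.2⟩
  · exact antitoneOn_ellipticE_div_ellipticK.reflect_lt (Ioo_subset_Ico_self hpZero)
      (Ioo_subset_Ico_self hpHat) (show _ / _ < _ / _ by linarith)
  · exact antitoneOn_ellipticE_div_ellipticK.reflect_lt (Ioo_subset_Ico_self hpCheck)
      (Ioo_subset_Ico_self hpZero) (show _ / _ < _ / _ by linarith)
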